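/- There exists an absolute constant C > 0 such that the following holds. Let f : ℝⁿ → ℝ be Lipschitz with |f(x) − f(y)| ≤ b‖x − y‖₂ and |f(x) − f(y)| ≤ a‖x − y‖_∞ for all x, y ∈ ℝⁿ, and suppose that ∫ |∂ᵢ f| dγₙ ≤ A for every i = 1, …, n. Set F = f − ∫ f dγₙ. Then for every λ > 0, Var_{γₙ}(e^{λF}) ≤ ( C λ² b² / log(e + b²/(aA)) ) · ∫ e^{2λF} dγₙ. -/

import Mathlib

open MeasureTheory ProbabilityTheory Real

/-- The standard Gaussian measure `γₙ` on `ℝⁿ`. -/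
noncomputable def stdGaussian (n : ℕ) : Measure (Fin n → ℝ) :=
  Measure.pi fun _ => gaussianReal 0 1

/-- The Euclidean norm on `ℝⁿ`. -/
noncomputable def euclNorm {n : ℕ} (x : Fin n → ℝ) : ℝ :=
  Real.sqrt (∑ i, (x i) ^ 2)

/-- The `i`-th partial derivative of `f : ℝⁿ → ℝ` (defined via the Fréchet derivative;
for a Lipschitz `f` this agrees a.e. with the usual partial derivative by Rademacher). -/
noncomputable def partialDeriv {n : ℕ} (f : (Fin n → ℝ) → ℝ) (i : Fin n)
    (x : Fin n → ℝ) : ℝ :=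
  fderiv ℝ f x (Pi.single i 1)

section Helpers

open Filter Topology Finset
open scoped BigOperators NNReal

/-! ### A Talagrand-type inequality on the discrete cube -/

section Cube

variable {ι : Type*} [DecidableEq ι]

/-- The discrete derivative of `G` on the cube in the direction `j`. -/
def cubeDiff (G : (ι → Bool) → ℝ) (j : ι) (ε : ι → Bool) : ℝ :=
  G ε - G (Function.update ε j (!ε j))

/-- The Dirichlet form on the cube. -/
noncomputable def cubeEnergy [Fintype ι] (G : (ι → Bool) → ℝ) : ℝ :=
  ∑ j, 𝔼 ε, cubeDiff G j ε ^ 2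

lemma expect_cube_succ {N : ℕ} (G : (Fin (N + 1) → Bool) → ℝ) :
    𝔼 ε, G ε = 𝔼 ε : Fin N → Bool, (G (Fin.cons true ε) + G (Fin.cons false ε)) / 2 := by
  simp only [Fintype.expect_eq_sum_div_card]
  rw [← (Fin.consEquiv (fun _ => Bool)).sum_comp, Fintype.sum_prod_type, Fintype.sum_bool]
  simp only [Fin.consEquiv, Equiv.coe_fn_mk, Fintype.card_pi, Fintype.card_bool, prod_const,
    card_univ, Fintype.card_fin, Nat.cast_pow, Nat.cast_ofNat, pow_succ, ← Finset.sum_div,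
    Finset.sum_add_distrib]
  field_simp
  push_cast
  ring

lemma cubeDiff_cons_zero {N : ℕ} (G : (Fin (N + 1) → Bool) → ℝ) (b : Bool) (ε : Fin N → Bool) :
    cubeDiff G 0 (Fin.cons b ε) = G (Fin.cons b ε) - G (Fin.cons (!b) ε) := by
  simp [cubeDiff, Fin.update_cons_zero]

lemma cubeDiff_cons_succ {N : ℕ} (G : (Fin (N + 1) → Bool) → ℝ) (b : Bool) (j : Fin N)
    (ε : Fin N → Bool) :
    cubeDiff G j.succ (Fin.cons b ε) = cubeDiff (fun η => G (Fin.cons b η)) j ε := by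
  simp [cubeDiff, Fin.cons_update]

lemma cubeEnergy_succ {N : ℕ} (G : (Fin (N + 1) → Bool) → ℝ) :
    cubeEnergy G = 𝔼 ε : Fin N → Bool, (G (Fin.cons true ε) - G (Fin.cons false ε)) ^ 2 +
      ∑ j, 𝔼 ε : Fin N → Bool, (cubeDiff (fun η => G (Fin.cons true η)) j ε ^ 2 +
        cubeDiff (fun η => G (Fin.cons false η)) j ε ^ 2) / 2 := by
  unfold cubeEnergy
  rw [Fin.sum_univ_succ, expect_cube_succ]
  congr 1
  · refine Finset.expect_congr rfl fun ε _ => ?_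
    rw [cubeDiff_cons_zero, cubeDiff_cons_zero]
    simp only [Bool.not_true, Bool.not_false]
    ring
  · refine Finset.sum_congr rfl fun j _ => ?_
    rw [expect_cube_succ]
    simp only [cubeDiff_cons_succ]

/-- The two-point logarithmic Sobolev inequality (with a non-optimal constant). -/
lemma two_point_logSobolev (a b : ℝ) :
    (a ^ 2 * log (a ^ 2) + b ^ 2 * log (b ^ 2)) / 2 ≤
      (a ^ 2 + b ^ 2) / 2 * log ((a ^ 2 + b ^ 2) / 2) + (a - b) ^ 2 := by
  set s := (a ^ 2 + b ^ 2) / 2 with hs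
  rcases eq_or_lt_of_le (show 0 ≤ s by positivity) with h0 | hpos
  · have ha : a = 0 := by nlinarith [sq_nonneg a, sq_nonneg b]
    have hb : b = 0 := by nlinarith [sq_nonneg a, sq_nonneg b]
    simp [← h0, ha, hb]
  · have key : ∀ x : ℝ, x ^ 2 * log (x ^ 2) ≤ x ^ 2 * (log s + (x ^ 2 / s - 1)) := by
      intro x
      rcases eq_or_ne x 0 with rfl | hx
      · simp
      · have hx2 : 0 < x ^ 2 := by positivity
        have := Real.log_le_sub_one_of_pos (div_pos hx2 hpos)
        rw [Real.log_div hx2.ne' hpos.ne'] at this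
        exact mul_le_mul_of_nonneg_left (by linarith) hx2.le
    have h1 := key a
    have h2 := key b
    have h3 : (a ^ 2 * (a ^ 2 / s - 1) + b ^ 2 * (b ^ 2 / s - 1)) / 2 ≤ (a - b) ^ 2 := by
      have e : (a ^ 2 * (a ^ 2 / s - 1) + b ^ 2 * (b ^ 2 / s - 1)) / 2
          = ((a ^ 2) ^ 2 + (b ^ 2) ^ 2 - 2 * s ^ 2) / (2 * s) := by
        have h2s : a ^ 2 + b ^ 2 = 2 * s := by rw [hs]; ring
        field_simp
        linear_combination (-s) * h2s
      rw [e, div_le_iff₀ (by positivity), hs]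
      nlinarith [mul_nonneg (sq_nonneg (a - b)) (sq_nonneg (a - b))]
    have h4 : a ^ 2 * log s + b ^ 2 * log s = 2 * (s * log s) := by rw [hs]; ring
    nlinarith

/-- The logarithmic Sobolev inequality on the discrete cube. -/
lemma cube_logSobolev {N : ℕ} (h : (Fin N → Bool) → ℝ) :
    𝔼 ε, h ε ^ 2 * log (h ε ^ 2) ≤
      (𝔼 ε, h ε ^ 2) * log (𝔼 ε, h ε ^ 2) + cubeEnergy h := by
  induction N with
  | zero => simp [cubeEnergy]
  | succ N ih =>
    set u := fun ε : Fin N → Bool => h (Fin.cons true ε) with hu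
    set v := fun ε : Fin N → Bool => h (Fin.cons false ε) with hv
    set k := fun ε : Fin N → Bool => √((u ε ^ 2 + v ε ^ 2) / 2) with hk
    have hk2 : ∀ ε, k ε ^ 2 = (u ε ^ 2 + v ε ^ 2) / 2 := fun ε =>
      Real.sq_sqrt (by positivity)
    have hkk := ih k
    have e1 : 𝔼 ε, h ε ^ 2 = 𝔼 ε, k ε ^ 2 := by
      rw [expect_cube_succ]; simp only [hk2, hu, hv]
    have e2 : 𝔼 ε, h ε ^ 2 * log (h ε ^ 2) ≤
        𝔼 ε, (k ε ^ 2 * log (k ε ^ 2)) + 𝔼 ε, (u ε - v ε) ^ 2 := by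
      rw [expect_cube_succ, ← Finset.expect_add_distrib]
      refine Finset.expect_le_expect fun ε _ => ?_
      rw [hk2]
      exact two_point_logSobolev _ _
    have e3 : cubeEnergy k ≤ ∑ j, 𝔼 ε, (cubeDiff u j ε ^ 2 + cubeDiff v j ε ^ 2) / 2 := by
      refine Finset.sum_le_sum fun j _ => Finset.expect_le_expect fun ε _ => ?_
      set η := Function.update ε j (!ε j)
      have hη : ∀ w, cubeDiff w j ε = w ε - w η := fun w => rfl
      rw [hη, hη, hη]
      have a1 := hk2 ε
      have a2 := hk2 η
      have a3 : (u ε * u η + v ε * v η) / 2 ≤ k ε * k η := by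
        refine le_of_sq_le_sq ?_ (by positivity)
        rw [mul_pow, a1, a2]
        nlinarith [sq_nonneg (u ε * v η - v ε * u η)]
      nlinarith
    have e4 := cubeEnergy_succ h
    rw [e1]
    linarith

lemma mul_expect_sq_le {κ : Type*} [Fintype κ] [Nonempty κ] (X : κ → ℝ) (τ : ℝ) :
    τ * 𝔼 x, X x ^ 2 ≤ 𝔼 x, X x ^ 2 * log (X x ^ 2) - (𝔼 x, X x ^ 2) * log (𝔼 x, X x ^ 2)
      + exp (τ - 1) * (𝔼 x, |X x|) ^ 2 := by
  set S := 𝔼 x, X x ^ 2 with hS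
  set m := 𝔼 x, |X x| with hm
  have hm0 : 0 ≤ m := Finset.expect_nonneg fun x _ => abs_nonneg _
  have hS0 : 0 ≤ S := Finset.expect_nonneg fun x _ => sq_nonneg _
  by_cases hX : ∀ x, X x = 0
  · simp [hS, hm, hX]
  push Not at hX
  obtain ⟨x₀, hx₀⟩ := hX
  have hSpos : 0 < S := Finset.expect_pos' (fun x _ => sq_nonneg _) ⟨x₀, mem_univ _, by positivity⟩
  have hmpos : 0 < m := Finset.expect_pos' (fun x _ => abs_nonneg _) ⟨x₀, mem_univ _, by positivity⟩
  set c := S / m with hc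
  have hcpos : 0 < c := by positivity
  have h1 : S * (2 * (log c + 1)) - 2 * c * m ≤ 𝔼 x, X x ^ 2 * log (X x ^ 2) := by
    rw [hS, hm, Finset.expect_mul, Finset.mul_expect, ← Finset.expect_sub_distrib]
    refine Finset.expect_le_expect fun x _ => ?_
    rcases eq_or_ne (X x) 0 with h0 | h0
    · simp [h0]
    · have hx : 0 < |X x| := abs_pos.2 h0
      have := Real.log_le_sub_one_of_pos (div_pos hcpos hx)
      rw [Real.log_div hcpos.ne' hx.ne'] at this
      rw [← sq_abs (X x), Real.log_pow]
      have h3 := mul_le_mul_of_nonneg_left this (sq_nonneg |X x|)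
      have h4 : |X x| ^ 2 * (c / |X x| - 1) = c * |X x| - |X x| ^ 2 := by field_simp
      rw [h4] at h3
      push_cast
      nlinarith
  have h2 : c * m = S := by rw [hc]; field_simp
  have h3 := Real.log_le_sub_one_of_pos
    (show 0 < exp (τ - 1) * (m ^ 2 / S) by positivity)
  rw [Real.log_mul (by positivity) (by positivity), Real.log_exp,
    Real.log_div (by positivity) (by positivity), Real.log_pow] at h3
  have h4 : log c = log S - log m := Real.log_div hSpos.ne' hmpos.ne'
  have h5 := mul_le_mul_of_nonneg_left h3 hS0
  have h6 : S * (exp (τ - 1) * (m ^ 2 / S) - 1) = exp (τ - 1) * m ^ 2 - S := by field_simp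
  rw [h6] at h5
  push_cast at h5
  rw [h4] at h1
  nlinarith

/-- A linearised Talagrand (`L¹`-`L²`) inequality on the discrete cube. -/
lemma cube_talagrand_fin {N : ℕ} (G : (Fin N → Bool) → ℝ) (τ : ℝ) :
    τ * (𝔼 ε, G ε ^ 2 - (𝔼 ε, G ε) ^ 2) ≤
      cubeEnergy G + exp (τ - 1) * ∑ j, (𝔼 ε, |cubeDiff G j ε|) ^ 2 / 4 := by
  induction N with
  | zero => simp [cubeEnergy]
  | succ N ih =>
    set u := fun ε : Fin N → Bool => G (Fin.cons true ε) with hu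
    set v := fun ε : Fin N → Bool => G (Fin.cons false ε) with hv
    set w := fun ε : Fin N → Bool => (u ε + v ε) / 2 with hw
    set d := fun ε : Fin N → Bool => (u ε - v ε) / 2 with hd
    have i1 := ih w
    have i2 := mul_expect_sq_le d τ
    have i3 := cube_logSobolev d
    have e1 : 𝔼 ε, G ε = 𝔼 ε, w ε := expect_cube_succ G
    have e2 : 𝔼 ε, G ε ^ 2 = 𝔼 ε, w ε ^ 2 + 𝔼 ε, d ε ^ 2 := by
      rw [expect_cube_succ, ← Finset.expect_add_distrib]
      refine Finset.expect_congr rfl fun ε _ => ?_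
      simp only [hw, hd, hu, hv]; ring
    have e3 : cubeEnergy w + cubeEnergy d ≤ cubeEnergy G := by
      rw [cubeEnergy_succ, cubeEnergy, cubeEnergy, ← Finset.sum_add_distrib]
      refine le_add_of_nonneg_of_le (Finset.expect_nonneg fun _ _ => sq_nonneg _) ?_
      refine Finset.sum_le_sum fun j _ => ?_
      rw [← Finset.expect_add_distrib]
      refine (Finset.expect_congr rfl fun ε _ => ?_).le
      simp only [cubeDiff, hw, hd, hu, hv]; ring
    have e4 : (𝔼 ε, |d ε|) ^ 2 + ∑ j, (𝔼 ε, |cubeDiff w j ε|) ^ 2 / 4 ≤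
        ∑ j, (𝔼 ε, |cubeDiff G j ε|) ^ 2 / 4 := by
      rw [Fin.sum_univ_succ (n := N)]
      refine add_le_add (le_of_eq ?_) (Finset.sum_le_sum fun j _ => ?_)
      · have : 𝔼 ε, |cubeDiff G 0 ε| = 2 * 𝔼 ε, |d ε| := by
          rw [expect_cube_succ, Finset.mul_expect]
          refine Finset.expect_congr rfl fun ε _ => ?_
          rw [cubeDiff_cons_zero, cubeDiff_cons_zero]
          simp only [Bool.not_true, Bool.not_false, hd, hu, hv, abs_div, abs_two]
          rw [abs_sub_comm (G (Fin.cons false ε))]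
          ring
        rw [this]; ring
      · have : 𝔼 ε, |cubeDiff w j ε| ≤ 𝔼 ε, |cubeDiff G j.succ ε| := by
          rw [expect_cube_succ]
          refine Finset.expect_le_expect fun ε _ => ?_
          rw [cubeDiff_cons_succ, cubeDiff_cons_succ]
          have : cubeDiff w j ε = (cubeDiff u j ε + cubeDiff v j ε) / 2 := by
            simp only [cubeDiff, hw]; ring
          rw [this, abs_div, abs_two]
          gcongr
          exact abs_add_le _ _
        have h0 : 0 ≤ 𝔼 ε, |cubeDiff w j ε| := Finset.expect_nonneg fun _ _ => abs_nonneg _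
        gcongr
    have e5 := mul_le_mul_of_nonneg_left e4 (exp_pos (τ - 1)).le
    rw [e1, e2]
    linarith

lemma cube_talagrand [Fintype ι] (G : (ι → Bool) → ℝ) (τ : ℝ) :
    τ * (𝔼 ε, G ε ^ 2 - (𝔼 ε, G ε) ^ 2) ≤
      cubeEnergy G + exp (τ - 1) * ∑ j, (𝔼 ε, |cubeDiff G j ε|) ^ 2 / 4 := by
  let e := Fintype.equivFin ι
  let E : (ι → Bool) ≃ (Fin (Fintype.card ι) → Bool) := Equiv.arrowCongr e (Equiv.refl Bool)
  have hE : ∀ F : (ι → Bool) → ℝ, 𝔼 η, F (E.symm η) = 𝔼 ε, F ε := fun F =>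
    Fintype.expect_equiv E.symm _ _ fun _ => rfl
  have hd : ∀ j η, cubeDiff (fun η => G (E.symm η)) (e j) η = cubeDiff G j (E.symm η) := by
    intro j η
    simp only [cubeDiff]
    congr 2
    ext i
    by_cases h : i = j
    · subst h; simp [E]
    · simp [E, h, Function.update_of_ne]
  have := cube_talagrand_fin (fun η => G (E.symm η)) τ
  simp only [cubeEnergy, ← e.sum_comp, hd] at this
  rw [hE (fun ε => G ε ^ 2), hE G] at this
  simp only [fun j => hE (fun ε => cubeDiff G j ε ^ 2),
    fun j => hE (fun ε => |cubeDiff G j ε|)] at this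
  exact this

end Cube

/-! ### The central limit theorem on product spaces -/

section CLT

/-- The fair coin. -/
noncomputable def coin : Measure Bool := (PMF.uniformOfFintype Bool).toMeasure

instance : IsProbabilityMeasure coin := by unfold coin; infer_instance

lemma coin_real_singleton (b : Bool) : coin.real {b} = 1 / 2 := by
  simp [coin, Measure.real]

/-- The sign `±1` attached to a Boolean. -/
def boolSign (b : Bool) : ℝ := if b then 1 else -1

/-- The standardised sum of `m` signs. -/
noncomputable def signSum {m : ℕ} (ω : Fin m → Bool) : ℝ := (√m)⁻¹ * ∑ k, boolSign (ω k)

/-- The law of the standardised sum of `m` independent fair signs. -/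
noncomputable def signSumLaw (m : ℕ) : ProbabilityMeasure ℝ :=
  ⟨(Measure.pi fun _ : Fin m => coin).map signSum,
    Measure.isProbabilityMeasure_map (measurable_of_finite _).aemeasurable⟩

lemma tendsto_signSumLaw :
    Tendsto signSumLaw atTop (𝓝 ⟨gaussianReal 0 1, inferInstance⟩) := by
  refine ProbabilityMeasure.tendsto_iff_tendsto_charFun.2 fun t => ?_
  have hmeas : AEMeasurable boolSign coin := (measurable_of_finite _).aemeasurable
  have key := tendsto_charFun_inv_sqrt_mul_pow (P := coin) (X := boolSign) hmeas
    (by simp [integral_fintype, coin_real_singleton, boolSign])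
    (by simp [integral_fintype, coin_real_singleton, boolSign]) t
  have hchar : ∀ m : ℕ, charFun (signSumLaw m : Measure ℝ) t =
      charFun (coin.map boolSign) ((√m)⁻¹ * t) ^ m := by
    intro m
    have hind : iIndepFun (fun (i : Fin m) (ω : Fin m → Bool) => boolSign (ω i))
        (Measure.pi fun _ : Fin m => coin) := iIndepFun_pi fun _ => hmeas
    have h1 : (signSumLaw m : Measure ℝ) = (Measure.pi fun _ : Fin m => coin).map
      (fun ω => (√m)⁻¹ * ∑ k, boolSign (ω k)) := rfl
    rw [h1, charFun_map_mul_comp (measurable_of_finite _).aemeasurable,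
      (hind.restrict _).charFun_map_fun_finsetSum_eq_prod
        (fun _ _ => (measurable_of_finite _).aemeasurable)]
    have h2 : ∀ i : Fin m, (Measure.pi fun _ : Fin m => coin).map (fun ω => boolSign (ω i)) =
        coin.map boolSign := by
      intro i
      have := (measurePreserving_eval (fun _ : Fin m => coin) i).map_eq
      conv_rhs => rw [← this]
      exact (Measure.map_map (measurable_of_finite boolSign) (measurable_pi_apply i)).symm
    simp [h2]
  simp only [hchar]
  simpa [charFun_gaussianReal, neg_div] using key

/-- The point of `ℝⁿ` whose coordinates are standardised sums of signs. -/
noncomputable def signPoint {n m : ℕ} (ε : Fin n × Fin m → Bool) : Fin n → ℝ :=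
  fun i => signSum fun k => ε (i, k)

lemma expect_signPoint {n m : ℕ} (Φ : (Fin n → ℝ) → ℝ) (hΦ : Continuous Φ) :
    𝔼 ε : Fin n × Fin m → Bool, Φ (signPoint ε) =
      ∫ x, Φ x ∂(ProbabilityMeasure.pi fun _ : Fin n => signSumLaw m) := by
  have h : ((ProbabilityMeasure.pi fun _ : Fin n => signSumLaw m : ProbabilityMeasure _) :
      Measure (Fin n → ℝ)) = (Measure.pi fun _ : Fin n => Measure.pi fun _ : Fin m => coin).map
        (fun ω i => signSum (ω i)) := by
    rw [Measure.pi_map_pi fun _ => (measurable_of_finite _).aemeasurable]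
    rfl
  rw [h, integral_map (measurable_of_finite _).aemeasurable hΦ.aestronglyMeasurable,
    integral_fintype Integrable.of_finite, Fintype.expect_eq_sum_div_card, Finset.sum_div]
  refine Fintype.sum_equiv (Equiv.curry (Fin n) (Fin m) Bool) _ _ fun ε => ?_
  have h2 : (Measure.pi fun _ : Fin n => Measure.pi fun _ : Fin m => coin).real
      {Equiv.curry (Fin n) (Fin m) Bool ε} = (1 / 2) ^ (n * m) := by
    have := coin_real_singleton
    simp only [Measure.real] at this
    simp only [Measure.real, Measure.pi_singleton, ENNReal.toReal_prod, this]
    simp [pow_mul, mul_comm n m]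
  rw [h2, smul_eq_mul]
  simp only [Fintype.card_pi, Fintype.card_bool, prod_const, card_univ, Fintype.card_prod,
    Fintype.card_fin]
  push_cast
  rw [div_eq_mul_inv, mul_comm, one_div, inv_pow]
  rfl

lemma tendsto_expect_signPoint {n : ℕ} (Φ : (Fin n → ℝ) → ℝ) (hΦ : Continuous Φ) (B : ℝ)
    (hB : ∀ x, |Φ x| ≤ B) :
    Tendsto (fun m : ℕ => 𝔼 ε : Fin n × Fin m → Bool, Φ (signPoint ε)) atTop
      (𝓝 (∫ x, Φ x ∂_root_.stdGaussian n)) := by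
  simp only [expect_signPoint Φ hΦ]
  have h1 : Tendsto (fun m => ProbabilityMeasure.pi fun _ : Fin n => signSumLaw m) atTop
      (𝓝 (ProbabilityMeasure.pi fun _ : Fin n =>
        (⟨gaussianReal 0 1, inferInstance⟩ : ProbabilityMeasure ℝ))) :=
    (ProbabilityMeasure.continuous_pi.tendsto _).comp
      (tendsto_pi_nhds.2 fun _ => tendsto_signSumLaw)
  exact ProbabilityMeasure.tendsto_iff_forall_integral_tendsto.1 h1
    (BoundedContinuousFunction.ofNormedAddCommGroup Φ hΦ B hB)

lemma signPoint_update {n m : ℕ} (ε : Fin n × Fin m → Bool) (i : Fin n) (k : Fin m) :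
    signPoint (Function.update ε (i, k) (!ε (i, k))) =
      signPoint ε + (-2 * (√m)⁻¹ * boolSign (ε (i, k))) • Pi.single i (1 : ℝ) := by
  ext i'
  by_cases h : i' = i
  · subst h
    simp only [signPoint, signSum, Pi.add_apply, Pi.smul_apply, Pi.single_eq_same, smul_eq_mul]
    have h1 : ∀ k', boolSign (Function.update ε (i', k) (!ε (i', k)) (i', k')) =
        boolSign (ε (i', k')) + if k' = k then -2 * boolSign (ε (i', k)) else 0 := by
      intro k'
      by_cases hk : k' = k
      · subst hk
        cases hb : ε (i', k') <;> simp [boolSign] <;> norm_num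
      · simp [hk, Function.update_of_ne]
    simp only [h1, Finset.sum_add_distrib, Finset.sum_ite_eq', Finset.mem_univ, if_true]
    ring
  · simp [signPoint, signSum, h, Function.update_of_ne]

lemma abs_boolSign (b : Bool) : |boolSign b| = 1 := by cases b <;> simp [boolSign]

/-- A linearised Talagrand (`L¹`-`L²`) inequality for the Gaussian measure. -/
lemma gaussian_talagrand {n : ℕ} (g : (Fin n → ℝ) → ℝ) (p : Fin n → (Fin n → ℝ) → ℝ) (B C : ℝ)
    (hg : Continuous g) (hp : ∀ i, Continuous (p i)) (hgB : ∀ x, |g x| ≤ B)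
    (hpB : ∀ i x, |p i x| ≤ B)
    (htaylor : ∀ i x (t : ℝ), |g (x + t • Pi.single i (1 : ℝ)) - g x - t * p i x| ≤ C * t ^ 2)
    (τ : ℝ) :
    τ * (∫ x, g x ^ 2 ∂_root_.stdGaussian n - (∫ x, g x ∂_root_.stdGaussian n) ^ 2) ≤
      4 * ∑ i, ∫ x, p i x ^ 2 ∂_root_.stdGaussian n +
        exp (τ - 1) * ∑ i, (∫ x, |p i x| ∂_root_.stdGaussian n) ^ 2 := by
  have hB2 : ∀ y : ℝ, |y| ≤ B → |y ^ 2| ≤ B ^ 2 := fun y hy => by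
    rw [abs_pow]; exact pow_le_pow_left₀ (abs_nonneg _) hy 2
  have l1 := tendsto_expect_signPoint g hg B hgB
  have l2 := tendsto_expect_signPoint (fun x => g x ^ 2) (hg.pow 2) (B ^ 2)
    fun x => hB2 _ (hgB x)
  have l3 := fun i => tendsto_expect_signPoint (fun x => |p i x|) (hp i).abs B
    fun x => by rw [abs_abs]; exact hpB i x
  have l4 := fun i => tendsto_expect_signPoint (fun x => p i x ^ 2) ((hp i).pow 2) (B ^ 2)
    fun x => hB2 _ (hpB i x)
  have l5 : Tendsto (fun m : ℕ => 2 * C * (√m)⁻¹) atTop (𝓝 0) := by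
    have := (tendsto_inv_atTop_zero.comp
      (Real.tendsto_sqrt_atTop.comp tendsto_natCast_atTop_atTop)).const_mul (2 * C)
    simpa using this
  have hlim : Tendsto (fun m : ℕ =>
      4 * ∑ i, (𝔼 ε : Fin n × Fin m → Bool, p i (signPoint ε) ^ 2 +
        2 * (2 * C * (√m)⁻¹) * 𝔼 ε : Fin n × Fin m → Bool, |p i (signPoint ε)| +
          (2 * C * (√m)⁻¹) ^ 2) +
      exp (τ - 1) * ∑ i, (𝔼 ε : Fin n × Fin m → Bool, |p i (signPoint ε)| +
        2 * C * (√m)⁻¹) ^ 2) atTop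
      (𝓝 (4 * ∑ i, (∫ x, p i x ^ 2 ∂_root_.stdGaussian n +
        2 * 0 * ∫ x, |p i x| ∂_root_.stdGaussian n + 0 ^ 2) +
        exp (τ - 1) * ∑ i, (∫ x, |p i x| ∂_root_.stdGaussian n + 0) ^ 2)) := by
    refine Tendsto.add ?_ ?_
    · refine Tendsto.const_mul _ (tendsto_finsetSum _ fun i _ => ?_)
      exact ((l4 i).add ((l5.const_mul 2).mul (l3 i))).add (l5.pow 2)
    · refine Tendsto.const_mul _ (tendsto_finsetSum _ fun i _ => ?_)
      exact ((l3 i).add l5).pow 2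
  simp only [mul_zero, zero_mul, add_zero, ne_eq, OfNat.ofNat_ne_zero, not_false_eq_true,
    zero_pow] at hlim
  refine le_of_tendsto_of_tendsto ((l2.sub (l1.pow 2)).const_mul τ) hlim ?_
  filter_upwards [eventually_gt_atTop 0] with m hm
  have hm' : (0 : ℝ) < m := by exact_mod_cast hm
  set δ := (√(m : ℝ))⁻¹ with hδ
  have hδ0 : 0 ≤ δ := by positivity
  have hδ2 : (m : ℝ) * δ ^ 2 = 1 := by
    rw [hδ, inv_pow, Real.sq_sqrt hm'.le]; field_simp
  have hdiff : ∀ i k (ε : Fin n × Fin m → Bool),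
      |cubeDiff (fun ε => g (signPoint ε)) (i, k) ε| ≤
        2 * δ * (|p i (signPoint ε)| + 2 * C * δ) := by
    intro i k ε
    simp only [cubeDiff, signPoint_update]
    set t := -2 * δ * boolSign (ε (i, k)) with ht
    have habs : |t| = 2 * δ := by
      rw [ht, abs_mul, abs_boolSign, abs_mul, abs_of_nonneg hδ0]; norm_num
    have h1 := htaylor i (signPoint ε) t
    have h2 : |t * p i (signPoint ε)| = 2 * δ * |p i (signPoint ε)| := by rw [abs_mul, habs]
    have h3 : t ^ 2 = 4 * δ ^ 2 := by rw [← sq_abs, habs]; ring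
    rw [h3] at h1
    have h4 := abs_add_le (g (signPoint ε + t • Pi.single i (1 : ℝ)) - g (signPoint ε)
      - t * p i (signPoint ε)) (t * p i (signPoint ε))
    rw [abs_sub_comm]
    have h5 : g (signPoint ε + t • Pi.single i (1 : ℝ)) - g (signPoint ε)
      - t * p i (signPoint ε) + t * p i (signPoint ε) =
      g (signPoint ε + t • Pi.single i (1 : ℝ)) - g (signPoint ε) := by ring
    rw [h5] at h4
    linarith
  refine (cube_talagrand (fun ε : Fin n × Fin m → Bool => g (signPoint ε)) τ).trans ?_
  refine add_le_add ?_ (mul_le_mul_of_nonneg_left ?_ (exp_pos _).le)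
  · rw [cubeEnergy, Fintype.sum_prod_type, Finset.mul_sum]
    refine Finset.sum_le_sum fun i _ => ?_
    have : ∀ k : Fin m, 𝔼 ε, cubeDiff (fun ε => g (signPoint ε)) (i, k) ε ^ 2 ≤
        4 * δ ^ 2 * (𝔼 ε : Fin n × Fin m → Bool, p i (signPoint ε) ^ 2 +
        2 * (2 * C * δ) * 𝔼 ε : Fin n × Fin m → Bool, |p i (signPoint ε)| +
          (2 * C * δ) ^ 2) := by
      intro k
      rw [Finset.mul_expect, ← Finset.expect_add_distrib,
        ← Finset.expect_const (s := (univ : Finset (Fin n × Fin m → Bool))) univ_nonempty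
          ((2 * C * δ) ^ 2), ← Finset.expect_add_distrib, Finset.mul_expect]
      refine Finset.expect_le_expect fun ε _ => ?_
      rw [← sq_abs (cubeDiff _ _ _), ← sq_abs (p i _)]
      refine (pow_le_pow_left₀ (abs_nonneg _) (hdiff i k ε) 2).trans_eq ?_
      ring
    refine (Finset.sum_le_sum fun k _ => this k).trans_eq ?_
    rw [Finset.sum_const, card_univ, Fintype.card_fin, nsmul_eq_mul]
    linear_combination (4 * (𝔼 ε : Fin n × Fin m → Bool, p i (signPoint ε) ^ 2 +
        2 * (2 * C * δ) * 𝔼 ε : Fin n × Fin m → Bool, |p i (signPoint ε)| +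
          (2 * C * δ) ^ 2)) * hδ2
  · rw [Fintype.sum_prod_type]
    refine Finset.sum_le_sum fun i _ => ?_
    have : ∀ k : Fin m, (𝔼 ε, |cubeDiff (fun ε => g (signPoint ε)) (i, k) ε|) ^ 2 / 4 ≤
        δ ^ 2 * (𝔼 ε : Fin n × Fin m → Bool, |p i (signPoint ε)| + 2 * C * δ) ^ 2 := by
      intro k
      have h1 : 𝔼 ε, |cubeDiff (fun ε => g (signPoint ε)) (i, k) ε| ≤
          2 * δ * (𝔼 ε : Fin n × Fin m → Bool, |p i (signPoint ε)| + 2 * C * δ) := by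
        rw [← Finset.expect_const (s := (univ : Finset (Fin n × Fin m → Bool))) univ_nonempty
          (2 * C * δ), ← Finset.expect_add_distrib, Finset.mul_expect]
        exact Finset.expect_le_expect fun ε _ => hdiff i k ε
      have h0 : 0 ≤ 𝔼 ε, |cubeDiff (fun ε => g (signPoint ε)) (i, k) ε| :=
        Finset.expect_nonneg fun _ _ => abs_nonneg _
      have := pow_le_pow_left₀ h0 h1 2
      linarith
    refine (Finset.sum_le_sum fun k _ => this k).trans_eq ?_
    rw [Finset.sum_const, card_univ, Fintype.card_fin, nsmul_eq_mul]
    linear_combination (𝔼 ε : Fin n × Fin m → Bool, |p i (signPoint ε)| + 2 * C * δ) ^ 2 * hδ2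

end CLT

/-! ### Exponentials of smooth functions -/

section Smooth

instance isProbabilityMeasure_stdGaussian_pi (n : ℕ) :
    IsProbabilityMeasure (_root_.stdGaussian n) := by
  unfold _root_.stdGaussian; infer_instance

/-- A weighted Cauchy-Schwarz inequality. -/
lemma sq_integral_mul_le {Ω : Type*} [MeasurableSpace Ω] {μ : Measure Ω} {w g : Ω → ℝ}
    (hw0 : ∀ x, 0 ≤ w x) (hw : Integrable w μ) (hwg : Integrable (fun x => w x * g x) μ)
    (hwg2 : Integrable (fun x => w x * g x ^ 2) μ) :
    (∫ x, w x * g x ∂μ) ^ 2 ≤ (∫ x, w x ∂μ) * ∫ x, w x * g x ^ 2 ∂μ := by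
  have h : ∀ s : ℝ, 0 ≤ (∫ x, w x ∂μ) * (s * s) + (-2 * ∫ x, w x * g x ∂μ) * s +
      ∫ x, w x * g x ^ 2 ∂μ := by
    intro s
    have h1 : 0 ≤ ∫ x, w x * (g x - s) ^ 2 ∂μ :=
      integral_nonneg fun x => mul_nonneg (hw0 x) (sq_nonneg _)
    have h2 : ∀ x, w x * (g x - s) ^ 2 = s * s * w x + (-2 * s) * (w x * g x) + w x * g x ^ 2 :=
      fun x => by ring
    simp only [h2] at h1
    have hi : Integrable (fun x => s * s * w x + (-2 * s) * (w x * g x)) μ :=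
      (hw.const_mul _).add (hwg.const_mul _)
    rw [integral_add hi hwg2, integral_add (hw.const_mul _) (hwg.const_mul _), integral_const_mul,
      integral_const_mul] at h1
    linarith
  have := discrim_le_zero h
  rw [discrim] at this
  nlinarith

lemma abs_sub_sub_mul_le_sq {u u' : ℝ → ℝ} {K : ℝ} (hu : ∀ x, HasDerivAt u (u' x) x)
    (hK : ∀ x y, |u' x - u' y| ≤ K * |x - y|) (x y : ℝ) :
    |u y - u x - (y - x) * u' x| ≤ K * (y - x) ^ 2 := by
  have h := (convex_uIcc x y).norm_image_sub_le_of_norm_hasDerivWithin_le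
    (f := fun z => u z - z * u' x) (f' := fun z => u' z - u' x) (C := K * |y - x|)
    (x := x) (y := y)
    (fun z _ => ((hu z).sub ((hasDerivAt_mul_const (u' x)))).hasDerivWithinAt)
    (fun z hz => by
      have hK0 : 0 ≤ K := by
        have := (abs_nonneg _).trans (hK 0 1); simpa using this
      refine (hK z x).trans (mul_le_mul_of_nonneg_left ?_ hK0)
      exact Set.abs_sub_left_of_mem_uIcc hz)
    Set.left_mem_uIcc Set.right_mem_uIcc
  rw [Real.norm_eq_abs, Real.norm_eq_abs, mul_assoc, ← sq, sq_abs] at h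
  convert h using 2
  ring

/-- A bounded smooth substitute for `y ↦ exp (l * y)`. -/
noncomputable def expSin (l R y : ℝ) : ℝ := exp (l * (R * sin (y / R)))

lemma hasDerivAt_expSin {l R : ℝ} (hR : R ≠ 0) (y : ℝ) :
    HasDerivAt (expSin l R) (l * cos (y / R) * expSin l R y) y := by
  have h : HasDerivAt (expSin l R) _ y :=
    ((((hasDerivAt_id y).div_const R).sin.const_mul R).const_mul l).exp
  refine h.congr_deriv ?_
  simp only [expSin, id]
  field_simp

lemma expSin_pos (l R y : ℝ) : 0 < expSin l R y := exp_pos _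

lemma expSin_le {l R : ℝ} (hl : 0 < l) (hR : 0 < R) (y : ℝ) : expSin l R y ≤ exp (l * R) := by
  refine exp_le_exp.2 (mul_le_mul_of_nonneg_left ?_ hl.le)
  exact mul_le_of_le_one_right hR.le (sin_le_one _)

lemma abs_deriv_expSin_le {l R : ℝ} (hl : 0 < l) (y : ℝ) :
    |l * cos (y / R) * expSin l R y| ≤ l * expSin l R y := by
  rw [abs_mul, abs_mul, abs_of_pos hl, abs_of_pos (expSin_pos l R y)]
  exact mul_le_mul_of_nonneg_right (mul_le_of_le_one_right hl.le (abs_cos_le_one _))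
    (expSin_pos l R y).le

lemma deriv_expSin_lipschitz {l R : ℝ} (hl : 0 < l) (hR : 0 < R) (x y : ℝ) :
    |l * cos (x / R) * expSin l R x - l * cos (y / R) * expSin l R y| ≤
      (l / R + l * l) * exp (l * R) * |x - y| := by
  have hd : ∀ z, HasDerivAt (fun z => l * cos (z / R) * expSin l R z)
      (l * (-sin (z / R) * (1 / R)) * expSin l R z +
        l * cos (z / R) * (l * cos (z / R) * expSin l R z)) z := fun z =>
    ((((hasDerivAt_id z).div_const R).cos.const_mul l)).mul (hasDerivAt_expSin hR.ne' z)
  have hb : ∀ z, ‖l * (-sin (z / R) * (1 / R)) * expSin l R z +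
        l * cos (z / R) * (l * cos (z / R) * expSin l R z)‖ ≤ (l / R + l * l) * exp (l * R) := by
    intro z
    have hE := expSin_le hl hR z
    have hE0 := expSin_pos l R z
    have h1 : |l * (-sin (z / R) * (1 / R))| ≤ l / R := by
      rw [abs_mul, abs_mul, abs_neg, abs_of_pos hl, abs_of_pos (by positivity : 0 < 1 / R),
        div_eq_mul_one_div l R]
      gcongr
      exact mul_le_of_le_one_left (by positivity) (abs_sin_le_one _)
    have h2 : |l * cos (z / R)| ≤ l := by
      rw [abs_mul, abs_of_pos hl]; exact mul_le_of_le_one_right hl.le (abs_cos_le_one _)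
    calc ‖l * (-sin (z / R) * (1 / R)) * expSin l R z +
          l * cos (z / R) * (l * cos (z / R) * expSin l R z)‖
        ≤ |l * (-sin (z / R) * (1 / R))| * |expSin l R z| +
          |l * cos (z / R)| * (|l * cos (z / R)| * |expSin l R z|) := by
          rw [Real.norm_eq_abs]
          refine (abs_add_le _ _).trans_eq ?_
          simp only [abs_mul]
      _ ≤ l / R * exp (l * R) + l * (l * exp (l * R)) := by
          rw [abs_of_pos hE0]
          gcongr
      _ = _ := by ring
  have := convex_univ.norm_image_sub_le_of_norm_hasDerivWithin_le
    (fun z _ => (hd z).hasDerivWithinAt) (fun z _ => hb z) (Set.mem_univ y) (Set.mem_univ x)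
  simpa using this

/-- The variance bound for `exp (l h)`, `h = R sin (F / R)`, when `F` is smooth. -/
lemma variance_expSin_le {n : ℕ} {F : (Fin n → ℝ) → ℝ} {q : Fin n → (Fin n → ℝ) → ℝ}
    {a b A D K l R : ℝ} (ha : 0 < a) (hl : 0 < l) (hR : 0 < R)
    (hF : Continuous F) (hq : ∀ i, Continuous (q i))
    (htaylor : ∀ i x (t : ℝ), |F (x + t • Pi.single i (1 : ℝ)) - F x - t * q i x| ≤ K * t ^ 2)
    (hlip : ∀ i x (t : ℝ), |F (x + t • Pi.single i (1 : ℝ)) - F x| ≤ a * |t|)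
    (hq1 : ∀ x, ∑ i, |q i x| ≤ a) (hq2 : ∀ x, ∑ i, q i x ^ 2 ≤ b ^ 2)
    (hA : ∀ i, ∫ x, |q i x| ∂_root_.stdGaussian n ≤ A) (hD0 : 0 ≤ D)
    (hD : b ^ 2 ≤ D ∨ a * A ≤ D) (τ : ℝ) :
    τ * (∫ x, expSin l R (F x) ^ 2 ∂_root_.stdGaussian n -
      (∫ x, expSin l R (F x) ∂_root_.stdGaussian n) ^ 2) ≤
      l ^ 2 * (4 * b ^ 2 + exp (τ - 1) * D) *
        ∫ x, expSin l R (F x) ^ 2 ∂_root_.stdGaussian n := by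
  set μ := _root_.stdGaussian n
  set g := fun x => expSin l R (F x) with hgdef
  set p := fun i x => l * cos (F x / R) * g x * q i x with hpdef
  have hucont : Continuous (expSin l R) :=
    continuous_iff_continuousAt.2 fun y => (hasDerivAt_expSin hR.ne' y).continuousAt
  have hgcont : Continuous g := hucont.comp hF
  have hpcont : ∀ i, Continuous (p i) := fun i => by
    have := hq i
    simp only [hpdef]; fun_prop
  have hg0 : ∀ x, 0 < g x := fun x => expSin_pos _ _ _
  have hgB : ∀ x, g x ≤ exp (l * R) := fun x => expSin_le hl hR _
  have hqa : ∀ i x, |q i x| ≤ a := fun i x =>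
    (Finset.single_le_sum (f := fun i => |q i x|) (fun _ _ => abs_nonneg _)
      (Finset.mem_univ i)).trans (hq1 x)
  have hple : ∀ i x, |p i x| ≤ l * (|q i x| * g x) := fun i x => by
    have := mul_le_mul_of_nonneg_right (abs_deriv_expSin_le (R := R) hl (F x)) (abs_nonneg (q i x))
    rw [← abs_mul] at this
    refine this.trans_eq ?_
    simp only [hgdef]; ring
  have hint : ∀ (w : (Fin n → ℝ) → ℝ) (M : ℝ), Continuous w → (∀ x, |w x| ≤ M) →
      Integrable w μ := fun w M hw hM =>
    Integrable.of_bound hw.aestronglyMeasurable M (Eventually.of_forall hM)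
  have hig2 : Integrable (fun x => g x ^ 2) μ := hint _ (exp (l * R) ^ 2) (hgcont.pow 2) fun x => by
    rw [abs_pow, abs_of_pos (hg0 x)]; exact pow_le_pow_left₀ (hg0 x).le (hgB x) 2
  have hiq : ∀ i, Integrable (fun x => |q i x|) μ := fun i => hint _ a (hq i).abs fun x => by
    rw [abs_abs]; exact hqa i x
  have hiqg : ∀ i, Integrable (fun x => |q i x| * g x) μ := fun i =>
    hint _ (a * exp (l * R)) ((hq i).abs.mul hgcont) fun x => by
      rw [abs_mul, abs_abs, abs_of_pos (hg0 x)]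
      exact mul_le_mul (hqa i x) (hgB x) (hg0 x).le ha.le
  have hiqg2 : ∀ i, Integrable (fun x => |q i x| * g x ^ 2) μ := fun i =>
    hint _ (a * exp (l * R) ^ 2) ((hq i).abs.mul (hgcont.pow 2)) fun x => by
      rw [abs_mul, abs_abs, abs_pow, abs_of_pos (hg0 x)]
      exact mul_le_mul (hqa i x) (pow_le_pow_left₀ (hg0 x).le (hgB x) 2) (by positivity) ha.le
  have hpB : ∀ i x, |p i x| ≤ l * (a * exp (l * R)) := fun i x =>
    (hple i x).trans (mul_le_mul_of_nonneg_left
      (mul_le_mul (hqa i x) (hgB x) (hg0 x).le ha.le) hl.le)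
  have hip : ∀ i, Integrable (fun x => |p i x|) μ := fun i =>
    hint _ (l * (a * exp (l * R))) (hpcont i).abs fun x => by rw [abs_abs]; exact hpB i x
  have hip2 : ∀ i, Integrable (fun x => p i x ^ 2) μ := fun i =>
    hint _ ((l * (a * exp (l * R))) ^ 2) ((hpcont i).pow 2) fun x => by
      rw [abs_pow]; exact pow_le_pow_left₀ (abs_nonneg _) (hpB i x) 2
  set G2 := ∫ x, g x ^ 2 ∂μ with hG2
  have hG20 : 0 ≤ G2 := integral_nonneg fun x => sq_nonneg _
  have henergy : ∑ i, ∫ x, p i x ^ 2 ∂μ ≤ l ^ 2 * b ^ 2 * G2 := by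
    rw [← integral_finsetSum _ fun i _ => hip2 i, hG2, ← integral_const_mul]
    refine integral_mono (integrable_finsetSum _ fun i _ => hip2 i) (hig2.const_mul _) fun x => ?_
    calc ∑ i, p i x ^ 2 ≤ ∑ i, (l ^ 2 * g x ^ 2) * q i x ^ 2 := by
          refine Finset.sum_le_sum fun i _ => ?_
          have := pow_le_pow_left₀ (abs_nonneg _) (hple i x) 2
          rw [sq_abs (p i x), mul_pow l, mul_pow |q i x|, sq_abs (q i x)] at this
          linarith
      _ = (l ^ 2 * g x ^ 2) * ∑ i, q i x ^ 2 := by rw [Finset.mul_sum]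
      _ ≤ (l ^ 2 * g x ^ 2) * b ^ 2 := mul_le_mul_of_nonneg_left (hq2 x) (by positivity)
      _ = l ^ 2 * b ^ 2 * g x ^ 2 := by ring
  have hL1 : ∑ i, (∫ x, |p i x| ∂μ) ^ 2 ≤ l ^ 2 * D * G2 := by
    rcases hD with hD | hD
    · have h1 : ∑ i, (∫ x, |p i x| ∂μ) ^ 2 ≤ ∑ i, ∫ x, p i x ^ 2 ∂μ := by
        refine Finset.sum_le_sum fun i _ => ?_
        have := sq_integral_mul_le (μ := μ) (w := fun _ => 1) (g := fun x => |p i x|)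
          (fun _ => zero_le_one) (integrable_const _) (by simpa using hip i)
          (by simpa using hip2 i)
        simpa using this
      calc _ ≤ l ^ 2 * b ^ 2 * G2 := h1.trans henergy
        _ ≤ l ^ 2 * D * G2 := by gcongr
    · have h1 : ∀ i, (∫ x, |p i x| ∂μ) ^ 2 ≤ l ^ 2 * A * ∫ x, |q i x| * g x ^ 2 ∂μ := by
        intro i
        have h2 : ∫ x, |p i x| ∂μ ≤ l * ∫ x, |q i x| * g x ∂μ := by
          rw [← integral_const_mul]
          exact integral_mono (hip i) ((hiqg i).const_mul _) (hple i)
        have h3 := sq_integral_mul_le (fun x => abs_nonneg (q i x)) (hiq i) (hiqg i) (hiqg2 i)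
        have h4 : 0 ≤ ∫ x, |q i x| * g x ^ 2 ∂μ := integral_nonneg fun x => by positivity
        have h5 := pow_le_pow_left₀ (integral_nonneg fun x => abs_nonneg (p i x)) h2 2
        calc _ ≤ _ := h5
          _ = l ^ 2 * (∫ x, |q i x| * g x ∂μ) ^ 2 := by ring
          _ ≤ l ^ 2 * (A * ∫ x, |q i x| * g x ^ 2 ∂μ) := by
            gcongr
            exact h3.trans (mul_le_mul_of_nonneg_right (hA i) h4)
          _ = _ := by ring
      by_cases hn : Nonempty (Fin n)
      · have hA0 : 0 ≤ A := (integral_nonneg fun x => abs_nonneg _).trans (hA hn.some)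
        calc ∑ i, (∫ x, |p i x| ∂μ) ^ 2 ≤ ∑ i, l ^ 2 * A * ∫ x, |q i x| * g x ^ 2 ∂μ :=
              Finset.sum_le_sum fun i _ => h1 i
          _ = l ^ 2 * A * ∫ x, ∑ i, |q i x| * g x ^ 2 ∂μ := by
              rw [← Finset.mul_sum, integral_finsetSum _ fun i _ => hiqg2 i]
          _ ≤ l ^ 2 * A * (a * G2) := by
              gcongr
              rw [hG2, ← integral_const_mul]
              refine integral_mono (integrable_finsetSum _ fun i _ => hiqg2 i)
                (hig2.const_mul _) fun x => ?_
              simp only [← Finset.sum_mul]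
              exact mul_le_mul_of_nonneg_right (hq1 x) (sq_nonneg _)
          _ = l ^ 2 * (a * A) * G2 := by ring
          _ ≤ l ^ 2 * D * G2 := by gcongr
      · rw [not_nonempty_iff] at hn
        simp only [Finset.univ_eq_empty, Finset.sum_empty]
        positivity
  have hT : ∀ i x (t : ℝ), |g (x + t • Pi.single i (1 : ℝ)) - g x - t * p i x| ≤
      ((l / R + l * l) * exp (l * R) * a ^ 2 + l * exp (l * R) * K) * t ^ 2 := by
    intro i x t
    set y := F (x + t • Pi.single i (1 : ℝ)) with hy
    have h1 := abs_sub_sub_mul_le_sq (fun z => hasDerivAt_expSin (l := l) hR.ne' z)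
      (deriv_expSin_lipschitz hl hR) (F x) y
    have h2 : (y - F x) ^ 2 ≤ a ^ 2 * t ^ 2 := by
      have := pow_le_pow_left₀ (abs_nonneg _) (hlip i x t) 2
      rwa [mul_pow, sq_abs, sq_abs] at this
    have h3 := (abs_deriv_expSin_le (R := R) hl (F x)).trans
      (mul_le_mul_of_nonneg_left (expSin_le hl hR (F x)) hl.le)
    set d := l * cos (F x / R) * expSin l R (F x) with hd
    have h4 : g (x + t • Pi.single i (1 : ℝ)) - g x - t * p i x =
        (expSin l R y - expSin l R (F x) - (y - F x) * d) + d * (y - F x - t * q i x) := by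
      simp only [hgdef, hpdef, hd, hy]; ring
    rw [h4]
    refine (abs_add_le _ _).trans ?_
    rw [abs_mul d, add_mul]
    refine add_le_add (h1.trans ?_) ?_
    · rw [mul_assoc _ (a ^ 2)]
      gcongr
    · rw [mul_assoc _ K]
      exact mul_le_mul h3 (htaylor i x t) (abs_nonneg _) (by positivity)
  have hfin := gaussian_talagrand g p (max (exp (l * R)) (l * (a * exp (l * R)))) _ hgcont hpcont
    (fun x => by rw [abs_of_pos (hg0 x)]; exact (hgB x).trans (le_max_left _ _))
    (fun i x => (hpB i x).trans (le_max_right _ _)) hT τ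
  refine hfin.trans ?_
  have := mul_le_mul_of_nonneg_left hL1 (exp_pos (τ - 1)).le
  linarith

end Smooth

/-! ### Mollification of Lipschitz functions -/

section Mollify

variable {n : ℕ} {f : (Fin n → ℝ) → ℝ} {a b : ℝ}

lemma lipschitzWith_of_abs_sub_le (ha : 0 ≤ a) (hfa : ∀ x y, |f x - f y| ≤ a * ‖x - y‖) :
    LipschitzWith a.toNNReal f :=
  LipschitzWith.of_dist_le_mul fun x y => by
    rw [Real.dist_eq, dist_eq_norm, Real.coe_toNNReal a ha]; exact hfa x y

lemma measurable_partialDeriv (f : (Fin n → ℝ) → ℝ) (i : Fin n) : Measurable (partialDeriv f i) :=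
  measurable_fderiv_apply_const ℝ f _

lemma fderiv_apply_eq_sum_partialDeriv (f : (Fin n → ℝ) → ℝ) (x c : Fin n → ℝ) :
    fderiv ℝ f x c = ∑ i, c i * partialDeriv f i x := by
  conv_lhs => rw [pi_eq_sum_univ' c]
  simp only [map_sum, map_smul, smul_eq_mul, partialDeriv]

lemma sum_abs_partialDeriv_le (ha : 0 ≤ a) (hfa : ∀ x y, |f x - f y| ≤ a * ‖x - y‖)
    (x : Fin n → ℝ) : ∑ i, |partialDeriv f i x| ≤ a := by
  set c : Fin n → ℝ := fun i => SignType.sign (partialDeriv f i x) with hc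
  have hc1 : ‖c‖ ≤ 1 := by
    refine (pi_norm_le_iff_of_nonneg zero_le_one).2 fun i => ?_
    simp only [hc]
    rcases SignType.sign (partialDeriv f i x) with _ | _ | _ <;> simp
  have h := (fderiv ℝ f x).le_opNorm c
  have h2 := norm_fderiv_le_of_lipschitz ℝ (x₀ := x) (lipschitzWith_of_abs_sub_le ha hfa)
  rw [Real.coe_toNNReal a ha] at h2
  have h3 : fderiv ℝ f x c = ∑ i, |partialDeriv f i x| := by
    rw [fderiv_apply_eq_sum_partialDeriv]
    exact Finset.sum_congr rfl fun i _ => sign_mul_self _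
  rw [← h3]
  calc fderiv ℝ f x c ≤ ‖fderiv ℝ f x‖ * ‖c‖ := (le_abs_self _).trans h
    _ ≤ a * 1 := mul_le_mul h2 hc1 (norm_nonneg _) ha
    _ = a := mul_one a

lemma abs_partialDeriv_le (ha : 0 ≤ a) (hfa : ∀ x y, |f x - f y| ≤ a * ‖x - y‖)
    (i : Fin n) (x : Fin n → ℝ) : |partialDeriv f i x| ≤ a :=
  (Finset.single_le_sum (f := fun i => |partialDeriv f i x|) (fun _ _ => abs_nonneg _)
    (Finset.mem_univ i)).trans (sum_abs_partialDeriv_le ha hfa x)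

lemma sum_sq_partialDeriv_le (hb : 0 ≤ b) (hfb : ∀ x y, |f x - f y| ≤ b * euclNorm (x - y))
    (x : Fin n → ℝ) : ∑ i, partialDeriv f i x ^ 2 ≤ b ^ 2 := by
  by_cases hd : DifferentiableAt ℝ f x
  · set c : Fin n → ℝ := fun i => partialDeriv f i x with hc
    set S := ∑ i, partialDeriv f i x ^ 2 with hS
    have hS0 : 0 ≤ S := Finset.sum_nonneg fun i _ => sq_nonneg _
    have h3 : fderiv ℝ f x c = S := by
      rw [fderiv_apply_eq_sum_partialDeriv]
      exact Finset.sum_congr rfl fun i _ => (sq _).symm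
    have hline : HasDerivAt (fun s : ℝ => f (x + s • c)) (fderiv ℝ f x c) 0 :=
      hd.hasFDerivAt.hasLineDerivAt c
    have h4 : ‖fderiv ℝ f x c‖ ≤ b * √S := by
      refine hline.le_of_lip' (by positivity) (Eventually.of_forall fun s => ?_)
      refine (hfb _ _).trans_eq ?_
      have : euclNorm (x + s • c - (x + (0 : ℝ) • c)) = √S * |s| := by
        rw [euclNorm, ← Real.sqrt_sq_eq_abs, ← Real.sqrt_mul hS0, hS, Finset.sum_mul]
        congr 1
        refine Finset.sum_congr rfl fun i _ => ?_
        simp [hc]; ring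
      rw [this, sub_zero, Real.norm_eq_abs, mul_assoc]
    rw [h3, Real.norm_eq_abs, abs_of_nonneg hS0] at h4
    have h5 : √S ≤ b := by
      by_contra! hlt
      have h6 : 0 < √S := hb.trans_lt hlt
      have := mul_lt_mul_of_pos_right hlt h6
      rw [Real.mul_self_sqrt hS0] at this
      linarith
    calc S = √S ^ 2 := (Real.sq_sqrt hS0).symm
      _ ≤ b ^ 2 := pow_le_pow_left₀ (Real.sqrt_nonneg _) h5 2
  · simp [partialDeriv, fderiv_zero_of_not_differentiableAt hd, sq_nonneg]

open scoped Convolution in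
/-- Lipschitz functions are limits of functions with Lipschitz gradients and the same bounds. -/
lemma exists_smooth_approx (ha : 0 ≤ a) (hb : 0 ≤ b)
    (hfb : ∀ x y, |f x - f y| ≤ b * euclNorm (x - y))
    (hfa : ∀ x y, |f x - f y| ≤ a * ‖x - y‖) :
    ∃ (F : ℕ → (Fin n → ℝ) → ℝ) (q : ℕ → Fin n → (Fin n → ℝ) → ℝ) (K : ℕ → ℝ),
      (∀ k, Continuous (F k)) ∧ (∀ k i, Continuous (q k i)) ∧
      (∀ k i x (t : ℝ), |F k (x + t • Pi.single i (1 : ℝ)) - F k x - t * q k i x| ≤ K k * t ^ 2) ∧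
      (∀ k i x (t : ℝ), |F k (x + t • Pi.single i (1 : ℝ)) - F k x| ≤ a * |t|) ∧
      (∀ k x, ∑ i, |q k i x| ≤ a) ∧ (∀ k x, ∑ i, q k i x ^ 2 ≤ b ^ 2) ∧
      (∀ k x, |F k x - f x| ≤ a * (2 / ((k : ℝ) + 1))) ∧
      ∀ i, ∀ᵐ x, Tendsto (fun k => q k i x) atTop (𝓝 (partialDeriv f i x)) := by
  have hlip := lipschitzWith_of_abs_sub_le ha hfa
  let φ : ℕ → ContDiffBump (0 : Fin n → ℝ) := fun k =>
    ⟨1 / ((k : ℝ) + 1), 2 / ((k : ℝ) + 1), by positivity, by gcongr; norm_num⟩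
  let w : ℕ → (Fin n → ℝ) → ℝ := fun k => (φ k).normed volume
  let L := ContinuousLinearMap.lsmul ℝ ℝ (E := ℝ)
  let F : ℕ → (Fin n → ℝ) → ℝ := fun k => w k ⋆[L, volume] f
  let q : ℕ → Fin n → (Fin n → ℝ) → ℝ := fun k i => w k ⋆[L, volume] partialDeriv f i
  have hF : ∀ k x, F k x = ∫ t, w k t * f (x - t) := fun k x => rfl
  have hq : ∀ k i x, q k i x = ∫ t, w k t * partialDeriv f i (x - t) := fun k i x => rfl
  have hw0 : ∀ k t, 0 ≤ w k t := fun k t => (φ k).nonneg_normed t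
  have hwc : ∀ k, Continuous (w k) := fun k => (φ k).continuous_normed
  have hwi : ∀ k, Integrable (w k) := fun k => (φ k).integrable_normed
  have hw1 : ∀ k, ∫ t, w k t = 1 := fun k => (φ k).integral_normed
  have hcs : ∀ k, HasCompactSupport (w k) := fun k => (φ k).hasCompactSupport_normed
  have hpm := measurable_partialDeriv f
  have hpa := abs_partialDeriv_le ha hfa
  have hwf : ∀ k x, Integrable fun t => w k t * f (x - t) := fun k x =>
    Continuous.integrable_of_hasCompactSupport
      ((hwc k).mul (hlip.continuous.comp (continuous_const.sub continuous_id)))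
      ((hcs k).mul_right)
  have hwp : ∀ k i x, Integrable fun t => w k t * partialDeriv f i (x - t) := fun k i x =>
    (hwi k).mul_bdd (c := a) ((hpm i).comp (measurable_const.sub measurable_id)).aestronglyMeasurable
      (Eventually.of_forall fun t => hpa i _)
  have hwp2 : ∀ k i x, Integrable fun t => w k t * partialDeriv f i (x - t) ^ 2 := fun k i x =>
    (hwi k).mul_bdd (c := a ^ 2)
      (((hpm i).comp (measurable_const.sub measurable_id)).pow_const 2).aestronglyMeasurable
      (Eventually.of_forall fun t => by
        rw [norm_pow]; exact pow_le_pow_left₀ (norm_nonneg _) (hpa i _) 2)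
  have hpl : ∀ i, LocallyIntegrable (partialDeriv f i) := fun i =>
    (locallyIntegrable_const a).mono (hpm i).aestronglyMeasurable
      (Eventually.of_forall fun x => (hpa i x).trans (le_abs_self a))
  have hFd : ∀ k i x (s : ℝ), HasDerivAt (fun s : ℝ => F k (x + s • Pi.single i (1 : ℝ)))
      (q k i (x + s • Pi.single i (1 : ℝ))) s := by
    intro k i x s
    simp only [hF, hq]
    refine (hasDerivAt_integral_of_dominated_loc_of_lip (bound := fun t => w k t * a)
      (s := Set.univ) univ_mem (Eventually.of_forall fun r => (hwf k _).aestronglyMeasurable)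
      (hwf k _) (hwp k i _).aestronglyMeasurable
      (Eventually.of_forall fun t => ?_) ((hwi k).mul_const a) ?_).2
    · refine LipschitzOnWith.of_dist_le_mul fun r _ r' _ => ?_
      rw [Real.dist_eq, Real.dist_eq, Real.coe_nnabs, abs_of_nonneg (mul_nonneg (hw0 k t) ha),
        ← mul_sub, abs_mul, abs_of_nonneg (hw0 k t), mul_assoc]
      refine mul_le_mul_of_nonneg_left ((hfa _ _).trans_eq ?_) (hw0 k t)
      have : x + r • Pi.single i (1 : ℝ) - t - (x + r' • Pi.single i (1 : ℝ) - t) =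
          (r - r') • Pi.single i (1 : ℝ) := by rw [sub_smul]; abel
      rw [this, norm_smul, Pi.norm_single, norm_one, mul_one, Real.norm_eq_abs]
    · have hae := (Measure.measurePreserving_sub_left volume
        (x + s • Pi.single i (1 : ℝ))).quasiMeasurePreserving.ae
        (hlip.ae_differentiableAt (μ := volume))
      filter_upwards [hae] with t ht
      refine HasDerivAt.const_mul _ ?_
      have h1 : HasDerivAt (fun r : ℝ => x + r • Pi.single i (1 : ℝ) - t)
          (Pi.single i (1 : ℝ)) s := by
        simpa using (((hasDerivAt_id s).smul_const (Pi.single i (1 : ℝ))).const_add x).sub_const t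
      exact ht.hasFDerivAt.comp_hasDerivAt s h1
  have hqd : ∀ k i x, HasFDerivAt (q k i)
      ((fderiv ℝ (w k) ⋆[L.precompL (Fin n → ℝ), volume] partialDeriv f i) x) x := fun k i x =>
    (hcs k).hasFDerivAt_convolution_left L (φ k).contDiff_normed (hpl i) x
  let K : ℕ → ℝ := fun k => ∫ t, ‖fderiv ℝ (w k) t‖ * a
  have hqK : ∀ k i x y, |q k i x - q k i y| ≤ K k * ‖x - y‖ := by
    intro k i x y
    have hdi : Integrable (fderiv ℝ (w k)) :=
      (((φ k).contDiff_normed (n := 1)).continuous_fderiv one_ne_zero).integrable_of_hasCompactSupport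
        ((hcs k).fderiv ℝ)
    refine convex_univ.norm_image_sub_le_of_norm_hasFDerivWithin_le
      (fun z _ => (hqd k i z).hasFDerivWithinAt) (fun z _ => ?_) (Set.mem_univ y) (Set.mem_univ x)
    refine norm_integral_le_of_norm_le (hdi.norm.mul_const a)
      (Eventually.of_forall fun t => ?_)
    refine ContinuousLinearMap.opNorm_le_bound _ (by positivity) fun v => ?_
    rw [ContinuousLinearMap.precompL_apply]
    change ‖fderiv ℝ (w k) t v * partialDeriv f i (z - t)‖ ≤ _
    rw [norm_mul, mul_right_comm]
    exact mul_le_mul (ContinuousLinearMap.le_opNorm _ _) (hpa i _) (norm_nonneg _) (by positivity)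
  refine ⟨F, q, K, fun k => ?_, fun k i => ?_, fun k i x t => ?_, fun k i x t => ?_, fun k x => ?_,
    fun k x => ?_, fun k x => ?_, fun i => ?_⟩
  · exact ((hcs k).continuous_convolution_left L (hwc k) hlip.continuous.locallyIntegrable)
  · exact continuous_iff_continuousAt.2 fun x => (hqd k i x).continuousAt
  · have := abs_sub_sub_mul_le_sq (hFd k i x) (K := K k) (fun s s' => ?_) 0 t
    · simpa using this
    · refine (hqK k i _ _).trans_eq ?_
      rw [add_sub_add_left_eq_sub, ← sub_smul, norm_smul, Pi.norm_single, norm_one, mul_one,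
        Real.norm_eq_abs]
  · have := convex_univ.norm_image_sub_le_of_norm_hasDerivWithin_le (C := a)
      (fun s _ => (hFd k i x s).hasDerivWithinAt) (fun s _ => ?_) (Set.mem_univ 0) (Set.mem_univ t)
    · simpa using this
    · refine (norm_integral_le_of_norm_le ((hwi k).mul_const a)
        (Eventually.of_forall fun t => ?_)).trans_eq ?_
      · change ‖w k t * partialDeriv f i _‖ ≤ _
        rw [norm_mul, Real.norm_of_nonneg (hw0 k t)]
        exact mul_le_mul_of_nonneg_left (hpa i _) (hw0 k t)
      · rw [integral_mul_const, hw1, one_mul]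
  · calc ∑ i, |q k i x| ≤ ∑ i, ∫ t, w k t * |partialDeriv f i (x - t)| := by
          refine Finset.sum_le_sum fun i _ => ?_
          rw [hq]
          refine (abs_integral_le_integral_abs).trans_eq ?_
          simp only [abs_mul, abs_of_nonneg (hw0 k _)]
      _ = ∫ t, w k t * ∑ i, |partialDeriv f i (x - t)| := by
          simp only [Finset.mul_sum]
          refine (integral_finsetSum _ fun i _ => ?_).symm
          simpa only [norm_mul, Real.norm_of_nonneg (hw0 k _), Real.norm_eq_abs] using
            (hwp k i x).norm
      _ ≤ ∫ t, w k t * a := by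
          refine integral_mono_of_nonneg (Eventually.of_forall fun t => ?_)
            ((hwi k).mul_const a) (Eventually.of_forall fun t => ?_)
          · exact mul_nonneg (hw0 k t) (Finset.sum_nonneg fun _ _ => abs_nonneg _)
          · exact mul_le_mul_of_nonneg_left (sum_abs_partialDeriv_le ha hfa _) (hw0 k t)
      _ = a := by rw [integral_mul_const, hw1, one_mul]
  · calc ∑ i, q k i x ^ 2 ≤ ∑ i, ∫ t, w k t * partialDeriv f i (x - t) ^ 2 := by
          refine Finset.sum_le_sum fun i _ => ?_
          have := sq_integral_mul_le (hw0 k) (hwi k) (hwp k i x) (hwp2 k i x)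
          rwa [hw1, one_mul] at this
      _ = ∫ t, w k t * ∑ i, partialDeriv f i (x - t) ^ 2 := by
          simp only [Finset.mul_sum]
          exact (integral_finsetSum _ fun i _ => hwp2 k i x).symm
      _ ≤ ∫ t, w k t * b ^ 2 := by
          refine integral_mono_of_nonneg (Eventually.of_forall fun t => ?_)
            ((hwi k).mul_const _) (Eventually.of_forall fun t => ?_)
          · exact mul_nonneg (hw0 k t) (Finset.sum_nonneg fun _ _ => sq_nonneg _)
          · exact mul_le_mul_of_nonneg_left (sum_sq_partialDeriv_le hb hfb _) (hw0 k t)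
      _ = b ^ 2 := by rw [integral_mul_const, hw1, one_mul]
  · refine (φ k).dist_normed_convolution_le hlip.continuous.aestronglyMeasurable fun y hy => ?_
    refine (hfa y x).trans (mul_le_mul_of_nonneg_left ?_ ha)
    rw [← dist_eq_norm]
    exact (Metric.mem_ball.1 hy).le
  · refine ContDiffBump.ae_convolution_tendsto_right_of_locallyIntegrable (φ := φ) (K := 2) ?_ ?_
      (hpl i)
    · change Tendsto (fun k : ℕ => 2 / ((k : ℝ) + 1)) atTop (𝓝 0)
      simpa [div_eq_mul_inv] using (tendsto_one_div_add_atTop_nhds_zero_nat (𝕜 := ℝ)).const_mul 2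
    · refine Eventually.of_forall fun k => ?_
      change 2 / ((k : ℝ) + 1) ≤ 2 * (1 / ((k : ℝ) + 1))
      rw [mul_one_div]

end Mollify

/-! ### Passage to the limit -/

section Limit

lemma stdGaussian_pi_absolutelyContinuous (n : ℕ) :
    _root_.stdGaussian n ≪ (volume : Measure (Fin n → ℝ)) := by
  unfold _root_.stdGaussian
  rw [volume_pi]
  induction n with
  | zero => rw [Measure.pi_of_empty, Measure.pi_of_empty]
  | succ n ih =>
    have h1 := (measurePreserving_piFinSuccAbove
      (fun _ : Fin (n + 1) => gaussianReal 0 1) 0).symm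
    have h2 := (measurePreserving_piFinSuccAbove
      (fun _ : Fin (n + 1) => (volume : Measure ℝ)) 0).symm
    rw [← h1.map_eq, ← h2.map_eq]
    exact ((gaussianReal_absolutelyContinuous 0 one_ne_zero).prod ih).map
      (MeasurableEquiv.measurable _)

lemma integrable_prod_exp_stdGaussian_pi (n : ℕ) (c : ℝ) :
    Integrable (fun x : Fin n → ℝ => ∏ i, exp (c * |x i|)) (_root_.stdGaussian n) :=
  Integrable.fintype_prod (f := fun _ : Fin n => fun y : ℝ => exp (c * |y|)) fun _ =>
    integrable_exp_mul_abs (X := id) (integrable_exp_mul_gaussianReal c)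
      (integrable_exp_mul_gaussianReal (-c))

lemma abs_le_abs_zero_add_sum {n : ℕ} {f : (Fin n → ℝ) → ℝ} {a : ℝ} (ha : 0 ≤ a)
    (hfa : ∀ x y, |f x - f y| ≤ a * ‖x - y‖) (x : Fin n → ℝ) :
    |f x| ≤ |f 0| + a * ∑ i, |x i| := by
  have h1 : ‖x‖ ≤ ∑ i, |x i| := by
    refine (pi_norm_le_iff_of_nonneg (Finset.sum_nonneg fun _ _ => abs_nonneg _)).2 fun i => ?_
    exact Finset.single_le_sum (f := fun i => |x i|) (fun _ _ => abs_nonneg _) (Finset.mem_univ i)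
  have h2 := hfa x 0
  rw [sub_zero] at h2
  have h3 := abs_sub_abs_le_abs_sub (f x) (f 0)
  have h4 := mul_le_mul_of_nonneg_left h1 ha
  linarith

lemma expSin_sq (l R y : ℝ) : expSin l R y ^ 2 = expSin (2 * l) R y := by
  rw [expSin, expSin, ← exp_nat_mul]
  congr 1
  push_cast
  ring

lemma mul_sin_div_eq {R : ℝ} (hR : R ≠ 0) (y : ℝ) : R * sin (y / R) = y * sinc (y / R) := by
  rcases eq_or_ne y 0 with rfl | hy
  · simp
  · rw [sinc_of_ne_zero (div_ne_zero hy hR)]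
    field_simp

lemma tendsto_integral_expSin {n : ℕ} {f : (Fin n → ℝ) → ℝ} {F : ℕ → (Fin n → ℝ) → ℝ} {a l : ℝ}
    (ha : 0 ≤ a) (hl : 0 < l) (hfa : ∀ x y, |f x - f y| ≤ a * ‖x - y‖)
    (hF : ∀ k, Continuous (F k)) (hFf : ∀ k x, |F k x - f x| ≤ a * (2 / ((k : ℝ) + 1))) :
    Tendsto (fun k : ℕ => ∫ x, expSin l ((k : ℝ) + 1) (F k x) ∂_root_.stdGaussian n) atTop
      (𝓝 (∫ x, exp (l * f x) ∂_root_.stdGaussian n)) := by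
  refine tendsto_integral_of_dominated_convergence
    (fun x => exp (l * (|f 0| + 2 * a)) * ∏ i, exp (l * a * |x i|)) (fun k => ?_)
    ((integrable_prod_exp_stdGaussian_pi n (l * a)).const_mul _) (fun k => ?_) ?_
  · have : Continuous (expSin l ((k : ℝ) + 1)) :=
      continuous_iff_continuousAt.2 fun y => (hasDerivAt_expSin (by positivity) y).continuousAt
    exact (this.comp (hF k)).aestronglyMeasurable
  · refine Eventually.of_forall fun x => ?_
    have hk : (0 : ℝ) < (k : ℝ) + 1 := by positivity
    rw [Real.norm_of_nonneg (expSin_pos _ _ _).le, ← exp_sum, ← exp_add, expSin, ← Finset.mul_sum,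
      mul_assoc, ← mul_add]
    refine exp_le_exp.2 (mul_le_mul_of_nonneg_left ?_ hl.le)
    have h1 : |((k : ℝ) + 1) * sin (F k x / ((k : ℝ) + 1))| ≤ |F k x| := by
      rw [mul_sin_div_eq hk.ne', abs_mul]
      exact mul_le_of_le_one_right (abs_nonneg _) (abs_sinc_le_one _)
    have h2 : 2 / ((k : ℝ) + 1) ≤ 2 := div_le_self zero_le_two (by linarith [k.cast_nonneg (α := ℝ)])
    have h3 := (hFf k x).trans (mul_le_mul_of_nonneg_left h2 ha)
    have h4 := abs_sub_abs_le_abs_sub (F k x) (f x)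
    have h5 := abs_le_abs_zero_add_sum ha hfa x
    have h6 := le_abs_self (((k : ℝ) + 1) * sin (F k x / ((k : ℝ) + 1)))
    linarith
  · refine Eventually.of_forall fun x => ?_
    have h0 : Tendsto (fun k : ℕ => ((k : ℝ) + 1)⁻¹) atTop (𝓝 0) := by
      simpa using tendsto_one_div_add_atTop_nhds_zero_nat (𝕜 := ℝ)
    have h1 : Tendsto (fun k => F k x) atTop (𝓝 (f x)) := by
      rw [tendsto_iff_dist_tendsto_zero]
      refine squeeze_zero (fun k => dist_nonneg) (fun k => hFf k x) ?_
      simpa [div_eq_mul_inv] using (h0.const_mul 2).const_mul a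
    have h2 : Tendsto (fun k : ℕ => F k x / ((k : ℝ) + 1)) atTop (𝓝 0) := by
      simpa [div_eq_mul_inv] using h1.mul h0
    have h3 := h1.mul ((continuous_sinc.tendsto 0).comp h2)
    rw [sinc_zero, mul_one] at h3
    refine ((continuous_exp.tendsto _).comp (h3.const_mul l)).congr fun k => ?_
    simp only [Function.comp, expSin]
    rw [mul_sin_div_eq (by positivity)]

/-- The variance bound for `exp (l f)`, with a free parameter `τ`. -/
lemma variance_exp_le {n : ℕ} {f : (Fin n → ℝ) → ℝ} {a b A D l : ℝ}
    (ha : 0 < a) (hb : 0 ≤ b) (hA0 : 0 < A) (hl : 0 < l)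
    (hfb : ∀ x y, |f x - f y| ≤ b * euclNorm (x - y))
    (hfa : ∀ x y, |f x - f y| ≤ a * ‖x - y‖)
    (hA : ∀ i : Fin n, ∫ x, |partialDeriv f i x| ∂_root_.stdGaussian n ≤ A)
    (hD0 : 0 ≤ D) (hD : b ^ 2 ≤ D ∨ a * (2 * A) ≤ D) (τ : ℝ) :
    τ * (∫ x, exp (2 * l * f x) ∂_root_.stdGaussian n -
      (∫ x, exp (l * f x) ∂_root_.stdGaussian n) ^ 2) ≤
      l ^ 2 * (4 * b ^ 2 + exp (τ - 1) * D) * ∫ x, exp (2 * l * f x) ∂_root_.stdGaussian n := by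
  obtain ⟨F, q, K, hF, hq, htaylor, hlip, hq1, hq2, hFf, hqlim⟩ :=
    exists_smooth_approx ha.le hb hfb hfa
  have hqA : ∀ i, Tendsto (fun k => ∫ x, |q k i x| ∂_root_.stdGaussian n) atTop
      (𝓝 (∫ x, |partialDeriv f i x| ∂_root_.stdGaussian n)) := fun i => by
    refine tendsto_integral_of_dominated_convergence (fun _ => a)
      (fun k => (hq k i).abs.aestronglyMeasurable) (integrable_const a)
      (fun k => Eventually.of_forall fun x => ?_) ?_
    · rw [Real.norm_eq_abs, abs_abs]
      exact (Finset.single_le_sum (f := fun i => |q k i x|) (fun _ _ => abs_nonneg _)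
        (Finset.mem_univ i)).trans (hq1 k x)
    · filter_upwards [(stdGaussian_pi_absolutelyContinuous n).ae_le (hqlim i)] with x hx using hx.abs
  have hev : ∀ᶠ k in atTop, ∀ i, ∫ x, |q k i x| ∂_root_.stdGaussian n ≤ 2 * A :=
    eventually_all.2 fun i =>
      ((hqA i).eventually_lt_const ((hA i).trans_lt (by linarith))).mono fun k hk => hk.le
  have hlim1 := tendsto_integral_expSin ha.le hl hfa hF hFf
  have hlim2 := tendsto_integral_expSin ha.le (by positivity : 0 < 2 * l) hfa hF hFf
  refine le_of_tendsto_of_tendsto ((hlim2.sub (hlim1.pow 2)).const_mul τ) (hlim2.const_mul _)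
    (hev.mono fun k hk => ?_)
  have := variance_expSin_le ha hl (by positivity : (0 : ℝ) < (k : ℝ) + 1) (hF k) (hq k)
    (htaylor k) (hlip k) (hq1 k) (hq2 k) hk hD0 hD τ
  simpa only [expSin_sq] using this

end Limit

end Helpers

/-- Two-level bound on the variance of `e^{λF}`, `F = f − E f`, for `f` which is
`b`-Lipschitz w.r.t. `‖·‖₂`, `a`-Lipschitz w.r.t. `‖·‖_∞`, with `‖∂ᵢ f‖_{L¹(γₙ)} ≤ A`:
`Var(e^{λF}) ≤ (C λ² b² / log(e + b²/(aA))) ∫ e^{2λF} dγₙ`. -/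
theorem statement2 :
    ∃ C > (0 : ℝ), ∀ (n : ℕ) (f : (Fin n → ℝ) → ℝ) (a b A : ℝ),
      0 < a → 0 < b → 0 < A →
      (∀ x y, |f x - f y| ≤ b * euclNorm (x - y)) →
      (∀ x y, |f x - f y| ≤ a * ‖x - y‖) →
      (∀ i : Fin n, ∫ x, |partialDeriv f i x| ∂stdGaussian n ≤ A) →
      ∀ l > (0 : ℝ),
        (∫ x, (Real.exp (l * (f x - ∫ y, f y ∂stdGaussian n))) ^ 2 ∂stdGaussian n)
            - (∫ x, Real.exp (l * (f x - ∫ y, f y ∂stdGaussian n)) ∂stdGaussian n) ^ 2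
          ≤ C * l ^ 2 * b ^ 2 / Real.log (Real.exp 1 + b ^ 2 / (a * A)) *
              ∫ x, Real.exp (2 * l * (f x - ∫ y, f y ∂stdGaussian n)) ∂stdGaussian n := by
  refine ⟨8, by norm_num, fun n f a b A ha hb hA hfb hfa hpA l hl => ?_⟩
  generalize ∫ y, f y ∂_root_.stdGaussian n = m
  set κ := b ^ 2 / (a * A) with hκ
  have hκ0 : 0 < κ := by positivity
  have hκA : a * A * κ = b ^ 2 := by rw [hκ]; field_simp
  set τ := Real.log (Real.exp 1 + κ) with hτ
  have he := Real.exp_pos 1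
  have hτ0 : 0 < τ := Real.log_pos (by linarith [Real.add_one_le_exp 1])
  have hexp : Real.exp (τ - 1) = 1 + κ / Real.exp 1 := by
    rw [Real.exp_sub, hτ, Real.exp_log (by positivity)]
    field_simp
  have he2 : (2 : ℝ) ≤ Real.exp 1 := by linarith [Real.add_one_le_exp 1]
  obtain ⟨D, hD0, hD, hDle⟩ : ∃ D, 0 ≤ D ∧ (b ^ 2 ≤ D ∨ a * (2 * A) ≤ D) ∧
      Real.exp (τ - 1) * D ≤ 4 * b ^ 2 := by
    have hκ2 : κ / Real.exp 1 ≤ κ / 2 := by gcongr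
    rw [hexp]
    rcases le_total κ 1 with h1 | h1
    · refine ⟨b ^ 2, sq_nonneg b, Or.inl le_rfl, ?_⟩
      gcongr
      linarith
    · refine ⟨a * (2 * A), by positivity, Or.inr le_rfl, ?_⟩
      have h2 : (1 + κ / Real.exp 1) * (a * (2 * A)) ≤ (2 * κ) * (a * (2 * A)) := by
        gcongr
        linarith
      calc _ ≤ _ := h2
        _ = 4 * b ^ 2 := by rw [← hκA]; ring
  have hmain := variance_exp_le ha hb.le hA hl hfb hfa hpA hD0 hD τ
  set E1 := ∫ x, Real.exp (l * f x) ∂_root_.stdGaussian n with hE1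
  set E2 := ∫ x, Real.exp (2 * l * f x) ∂_root_.stdGaussian n with hE2
  have hE20 : 0 ≤ E2 := integral_nonneg fun x => (Real.exp_pos _).le
  set s := Real.exp (-(l * m)) with hs
  have h1 : ∀ x, Real.exp (l * (f x - m)) = s * Real.exp (l * f x) := fun x => by
    rw [hs, ← Real.exp_add]; ring_nf
  have h2 : ∀ x, Real.exp (2 * l * (f x - m)) = s ^ 2 * Real.exp (2 * l * f x) := fun x => by
    rw [hs, ← Real.exp_nat_mul, ← Real.exp_add]; push_cast; ring_nf
  have h3 : ∀ x, Real.exp (l * (f x - m)) ^ 2 = s ^ 2 * Real.exp (2 * l * f x) := fun x => by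
    rw [← h2, ← Real.exp_nat_mul]; push_cast; ring_nf
  simp only [h3, h2]
  simp only [h1]
  rw [integral_const_mul, integral_const_mul, ← hE1, ← hE2, mul_pow, ← mul_sub,
    div_mul_eq_mul_div, le_div_iff₀ hτ0]
  have h4 : τ * (E2 - E1 ^ 2) ≤ l ^ 2 * (8 * b ^ 2) * E2 := by
    refine hmain.trans ?_
    gcongr
    linarith
  calc s ^ 2 * (E2 - E1 ^ 2) * τ = s ^ 2 * (τ * (E2 - E1 ^ 2)) := by ring
    _ ≤ s ^ 2 * (l ^ 2 * (8 * b ^ 2) * E2) := by gcongr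
    _ = 8 * l ^ 2 * b ^ 2 * (s ^ 2 * E2) := by ring
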